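/- Let n ≥ 2 and let TL(D_n) be the K-subalgebra of TL(B_n) generated by U_0 := s_0U_1s_0 together with U_1, …, U_{n−1}. There exists a unique element d ∈ TL(D_n) such that d ≠ 0, d² = d, and U_i·d = 0 = d·U_i for all 0 ≤ i ≤ n−1; moreover this element equals b_{n,+} + b_{n,−} (the type D Jones–Wenzl projector d_n). -/

import Mathlib

noncomputable section

/-- The ground field `K = ℂ(q)`, the complex rational functions. -/
abbrev K : Type := RatFunc ℂ

/-- The variable `q ∈ K = ℂ(q)`. -/
noncomputable def q : K := RatFunc.X

/-- `δ = q + q⁻¹ ∈ K`. -/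
noncomputable def δ : K := q + q⁻¹

/-- Defining relations of the type `B` Temperley–Lieb algebra `TL(Bₙ)` (over `K`, with
`δ = q + q⁻¹`): the generator of index `0` is `s₀` and the generator of index `i`
(for `1 ≤ i ≤ n-1`) is `Uᵢ`.  The relations are `Uᵢ² = δUᵢ`, `UᵢU_{i+1}Uᵢ = Uᵢ`,
`U_{i+1}UᵢU_{i+1} = U_{i+1}`, `UᵢUⱼ = UⱼUᵢ` for `|i-j| ≥ 2`, `s₀² = 1`, `U₁s₀U₁ = 0` and
`s₀Uᵢ = Uᵢs₀` for `i ≥ 2`. -/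
inductive TLBRel (n : ℕ) : FreeAlgebra K (Fin n) → FreeAlgebra K (Fin n) → Prop
  | Usq (i : Fin n) (hi : 1 ≤ (i : ℕ)) :
      TLBRel n (FreeAlgebra.ι K i * FreeAlgebra.ι K i) (δ • FreeAlgebra.ι K i)
  | braid₁ (i j : Fin n) (hi : 1 ≤ (i : ℕ)) (hj : (j : ℕ) = (i : ℕ) + 1) :
      TLBRel n (FreeAlgebra.ι K i * FreeAlgebra.ι K j * FreeAlgebra.ι K i) (FreeAlgebra.ι K i)
  | braid₂ (i j : Fin n) (hi : 1 ≤ (i : ℕ)) (hj : (j : ℕ) = (i : ℕ) + 1) :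
      TLBRel n (FreeAlgebra.ι K j * FreeAlgebra.ι K i * FreeAlgebra.ι K j) (FreeAlgebra.ι K j)
  | Ucomm (i j : Fin n) (hi : 1 ≤ (i : ℕ)) (h : (i : ℕ) + 2 ≤ (j : ℕ)) :
      TLBRel n (FreeAlgebra.ι K i * FreeAlgebra.ι K j) (FreeAlgebra.ι K j * FreeAlgebra.ι K i)
  | s0sq (i : Fin n) (hi : (i : ℕ) = 0) : TLBRel n (FreeAlgebra.ι K i * FreeAlgebra.ι K i) 1
  | UsU (i j : Fin n) (hi : (i : ℕ) = 0) (hj : (j : ℕ) = 1) :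
      TLBRel n (FreeAlgebra.ι K j * FreeAlgebra.ι K i * FreeAlgebra.ι K j) 0
  | s0comm (i j : Fin n) (hi : (i : ℕ) = 0) (h : 2 ≤ (j : ℕ)) :
      TLBRel n (FreeAlgebra.ι K i * FreeAlgebra.ι K j) (FreeAlgebra.ι K j * FreeAlgebra.ι K i)

/-- The type `B` Temperley–Lieb algebra `TL(Bₙ)` over `K = ℂ(q)` with `δ = q + q⁻¹`. -/
abbrev TLB (n : ℕ) := RingQuot (TLBRel n)

/-- The generator of `TL(Bₙ)` with index `i`: `g n 0 = s₀`, and `g n i = Uᵢ` for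
`1 ≤ i ≤ n-1` (indices out of range are sent to `0`). -/
noncomputable def g (n : ℕ) (i : ℕ) : TLB n :=
  if h : i < n then RingQuot.mkAlgHom K (TLBRel n) (FreeAlgebra.ι K ⟨i, h⟩) else 0

/-- `IsJW n ε b` says that `b` is a type `B` Jones–Wenzl projector of sign `ε` in `TL(Bₙ)`:
`b` is a nonzero idempotent with `s₀·b = ε·b = b·s₀` and `Uᵢ·b = 0 = b·Uᵢ` for all
`1 ≤ i ≤ n-1`.  For `ε = 1` this characterizes `b_{n,+}` and for `ε = -1` it characterizes
`b_{n,-}`. -/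
def IsJW (n : ℕ) (ε : K) (b : TLB n) : Prop :=
  b ≠ 0 ∧ b * b = b ∧ g n 0 * b = ε • b ∧ b * g n 0 = ε • b ∧
    ∀ i : ℕ, 1 ≤ i → i ≤ n - 1 → g n i * b = 0 ∧ b * g n i = 0

/-- `IsTypeDJW n d` says: `d` lies in the subalgebra `TL(Dₙ)` of `TL(Bₙ)` generated by
`U₀ := s₀U₁s₀` together with `U₁, …, U_{n-1}`, `d` is a nonzero idempotent, and `d` kills
`Uᵢ` for all `0 ≤ i ≤ n-1` (where `U₀ = s₀U₁s₀`). -/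
def IsTypeDJW (n : ℕ) (d : TLB n) : Prop :=
  d ∈ Algebra.adjoin K
      ({g n 0 * g n 1 * g n 0} ∪ {y : TLB n | ∃ i : ℕ, 1 ≤ i ∧ i ≤ n - 1 ∧ y = g n i}) ∧
  d ≠ 0 ∧ d * d = d ∧
  ((g n 0 * g n 1 * g n 0) * d = 0 ∧ d * (g n 0 * g n 1 * g n 0) = 0) ∧
  ∀ i : ℕ, 1 ≤ i → i ≤ n - 1 → g n i * d = 0 ∧ d * g n i = 0

/-! ### Linear algebra identities -/

section LinearIdentities

variable {F M : Type*} [Field F] [AddCommGroup M] [Module F M]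

lemma smul_sub_smul_add_self (a b : F) (x : M) : a • x - b • (x + x) = (a - 2 * b) • x := by
  module

lemma smul_add_smul_swap (a b a' b' : F) (x y : M) :
    a' • (a • x + b • y) + b' • (a • y + b • x) = (a' * a + b' * b) • x + (a' * b + b' * a) • y := by
  module

lemma smul_add_smul_add_smul_add_smul (a b a' b' : F) (x y : M) :
    a • x + b • y + (a' • x + b' • y) = (a + a') • x + (b + b') • y := by
  module

lemma half_smul_add_smul_swap {ε : F} (hε : ε * ε = 1) (a b : F) (x y : M) :
    (2⁻¹ : F) • (a • x + b • y + ε • (a • y + b • x)) = (a + ε * b) • (2⁻¹ : F) • (x + ε • y) := by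
  have h : b • y = (ε * ε * b) • y := by rw [hε, one_mul]
  rw [h]
  module

lemma half_smul_add_half_smul_neg [NeZero (2 : F)] (x y : M) :
    (2⁻¹ : F) • (x + (1 : F) • y) + (2⁻¹ : F) • (x + (-1 : F) • y) = x := by
  have h : (2⁻¹ : F) • (x + (1 : F) • y) + (2⁻¹ : F) • (x + (-1 : F) • y) = (2⁻¹ * 2 : F) • x := by
    module
  rw [h, inv_mul_cancel₀ two_ne_zero, one_smul]

end LinearIdentities

/-! ### The Chebyshev-type coefficients `qᵏ + q⁻ᵏ` -/

lemma q_ne_zero : q ≠ 0 := RatFunc.X_ne_zero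

/-- The coefficient `qᵏ + q⁻ᵏ ∈ K`. -/
def qPowSum (k : ℕ) : K := q ^ k + q⁻¹ ^ k

lemma qPowSum_ne_zero (k : ℕ) : qPowSum k ≠ 0 := by
  have hpoly : (Polynomial.X ^ (2 * k) + 1 : Polynomial ℂ) ≠ 0 := by
    intro h
    have h1 := congrArg (Polynomial.eval 1) h
    norm_num at h1
  have hq : q ^ (2 * k) + 1 ≠ 0 := by
    intro h
    apply hpoly
    apply RatFunc.algebraMap_injective ℂ
    simpa [q] using h
  intro h
  apply hq
  have hk : q ^ k * q⁻¹ ^ k = 1 := by rw [← mul_pow, mul_inv_cancel₀ q_ne_zero, one_pow]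
  have h2 : q ^ k * qPowSum k = 0 := by rw [h, mul_zero]
  rw [qPowSum, mul_add, hk, ← pow_add] at h2
  rwa [two_mul]

lemma qPowSum_add_two (k : ℕ) : qPowSum (k + 2) = δ * qPowSum (k + 1) - qPowSum k := by
  have h : q * q⁻¹ = 1 := mul_inv_cancel₀ q_ne_zero
  simp only [qPowSum, δ, pow_succ]
  linear_combination (-(q ^ k) - q⁻¹ ^ k) * h

lemma δ_eq_qPowSum : δ = qPowSum 1 := by simp [qPowSum, δ]

lemma δ_ne_zero : δ ≠ 0 := δ_eq_qPowSum ▸ qPowSum_ne_zero 1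

/-- The partial trace coefficient `(qᵏ⁺¹ + q⁻⁽ᵏ⁺¹⁾) / (qᵏ + q⁻ᵏ)`. -/
def traceCoeff (k : ℕ) : K := qPowSum (k + 1) / qPowSum k

lemma traceCoeff_ne_zero (k : ℕ) : traceCoeff k ≠ 0 :=
  div_ne_zero (qPowSum_ne_zero _) (qPowSum_ne_zero _)

lemma traceCoeff_succ (k : ℕ) : traceCoeff (k + 1) = δ - (traceCoeff k)⁻¹ := by
  have h0 := qPowSum_ne_zero k
  have h1 := qPowSum_ne_zero (k + 1)
  rw [traceCoeff, traceCoeff, qPowSum_add_two]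
  field_simp

lemma traceCoeff_one : traceCoeff 1 = δ - 2 * δ⁻¹ := by
  have h := δ_ne_zero
  have h0 : qPowSum 0 = 2 := by norm_num [qPowSum]
  rw [traceCoeff, qPowSum_add_two, h0, zero_add, ← δ_eq_qPowSum]
  field_simp

/-! ### Relations between the generators of `TL(Bₙ)` -/

section Relations

variable {n : ℕ}

lemma g_of_lt {i : ℕ} (h : i < n) :
    g n i = RingQuot.mkAlgHom K (TLBRel n) (FreeAlgebra.ι K ⟨i, h⟩) := dif_pos h

lemma g_of_ge {i : ℕ} (h : n ≤ i) : g n i = 0 := dif_neg (not_lt.mpr h)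

lemma g_zero_mul_self (hn : 0 < n) : g n 0 * g n 0 = 1 := by
  rw [g_of_lt hn, ← map_mul, RingQuot.mkAlgHom_rel K (TLBRel.s0sq ⟨0, hn⟩ rfl), map_one]

lemma g_mul_self {i : ℕ} (hi : 1 ≤ i) : g n i * g n i = δ • g n i := by
  rcases lt_or_ge i n with h | h
  · rw [g_of_lt h, ← map_mul, RingQuot.mkAlgHom_rel K (TLBRel.Usq ⟨i, h⟩ hi), map_smul]
  · simp [g_of_ge h]

lemma g_succ_mul_g_mul_g_succ {i : ℕ} (hi : 1 ≤ i) :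
    g n (i + 1) * g n i * g n (i + 1) = g n (i + 1) := by
  rcases lt_or_ge (i + 1) n with h | h
  · rw [g_of_lt h, g_of_lt (i.lt_succ_self.trans h), ← map_mul, ← map_mul,
      RingQuot.mkAlgHom_rel K (TLBRel.braid₂ ⟨i, i.lt_succ_self.trans h⟩ ⟨i + 1, h⟩ hi rfl)]
  · simp [g_of_ge h]

lemma g_commute {i j : ℕ} (hi : 1 ≤ i) (h : i + 2 ≤ j) : Commute (g n i) (g n j) := by
  rcases lt_or_ge j n with hj | hj
  · have hin : i < n := by omega
    rw [commute_iff_eq, g_of_lt hj, g_of_lt hin, ← map_mul, ← map_mul,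
      RingQuot.mkAlgHom_rel K (TLBRel.Ucomm ⟨i, hin⟩ ⟨j, hj⟩ hi h)]
  · simp [g_of_ge hj]

lemma g_one_mul_g_zero_mul_g_one : g n 1 * g n 0 * g n 1 = 0 := by
  rcases lt_or_ge 1 n with h | h
  · have h0 : 0 < n := by omega
    rw [g_of_lt h, g_of_lt h0, ← map_mul, ← map_mul,
      RingQuot.mkAlgHom_rel K (TLBRel.UsU ⟨0, h0⟩ ⟨1, h⟩ rfl rfl), map_zero]
  · simp [g_of_ge h]

lemma g_zero_commute {j : ℕ} (h : 2 ≤ j) : Commute (g n 0) (g n j) := by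
  rcases lt_or_ge j n with hj | hj
  · have h0 : 0 < n := by omega
    rw [commute_iff_eq, g_of_lt hj, g_of_lt h0, ← map_mul, ← map_mul,
      RingQuot.mkAlgHom_rel K (TLBRel.s0comm ⟨0, h0⟩ ⟨j, hj⟩ rfl h)]
  · simp [g_of_ge hj]

/-- The character of `TL(Bₙ)` with `s₀ ↦ 1` and `Uᵢ ↦ 0`. -/
def augmentation (n : ℕ) : TLB n →ₐ[K] K :=
  RingQuot.liftAlgHom K ⟨FreeAlgebra.lift K fun i : Fin n => if (i : ℕ) = 0 then 1 else 0, by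
    intro x y h
    induction h with
    | Usq i hi => simp [Nat.ne_of_gt hi]
    | braid₁ i j hi hj => simp [Nat.ne_of_gt hi]
    | braid₂ i j hi hj => simp [hj]
    | Ucomm i j hi h => simp [Nat.ne_of_gt hi]
    | s0sq i hi => simp [hi]
    | UsU i j hi hj => simp [hj]
    | s0comm i j hi h => simp [mul_comm]⟩

lemma augmentation_g {i : ℕ} (hi : 1 ≤ i) : augmentation n (g n i) = 0 := by
  rcases lt_or_ge i n with h | h
  · rw [g_of_lt h, augmentation, RingQuot.liftAlgHom_mkAlgHom_apply, FreeAlgebra.lift_ι_apply,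
      if_neg (Nat.ne_of_gt hi)]
  · rw [g_of_ge h, map_zero]

/-- The generator `U₀ = s₀U₁s₀` of `TL(Dₙ)`. -/
def gD (n : ℕ) : TLB n := g n 0 * g n 1 * g n 0

lemma gD_mul_self (hn : 0 < n) : gD n * gD n = δ • gD n := by
  calc gD n * gD n = g n 0 * g n 1 * (g n 0 * g n 0) * g n 1 * g n 0 := by
        simp only [gD, mul_assoc]
    _ = g n 0 * (g n 1 * g n 1) * g n 0 := by
        rw [g_zero_mul_self hn, mul_one]; simp only [mul_assoc]
    _ = δ • gD n := by rw [g_mul_self le_rfl]; simp [gD]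

lemma gD_mul_g_one : gD n * g n 1 = 0 := by
  calc gD n * g n 1 = g n 0 * (g n 1 * g n 0 * g n 1) := by simp only [gD, mul_assoc]
    _ = 0 := by rw [g_one_mul_g_zero_mul_g_one, mul_zero]

lemma g_one_mul_gD : g n 1 * gD n = 0 := by
  calc g n 1 * gD n = g n 1 * g n 0 * g n 1 * g n 0 := by simp only [gD, mul_assoc]
    _ = 0 := by rw [g_one_mul_g_zero_mul_g_one, zero_mul]

lemma gD_commute {j : ℕ} (hj : 3 ≤ j) : Commute (gD n) (g n j) := by
  have h0 : Commute (g n 0) (g n j) := g_zero_commute (by omega)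
  exact (h0.mul_left (g_commute le_rfl hj)).mul_left h0

lemma g_zero_mul_gD (hn : 0 < n) : g n 0 * gD n = g n 1 * g n 0 := by
  rw [gD, ← mul_assoc, ← mul_assoc, g_zero_mul_self hn, one_mul]

lemma gD_mul_g_zero (hn : 0 < n) : gD n * g n 0 = g n 0 * g n 1 := by
  rw [gD, mul_assoc, g_zero_mul_self hn, mul_one]

lemma g_two_mul_gD_mul_g_two (hn : 0 < n) : g n 2 * gD n * g n 2 = g n 2 := by
  have h0 : g n 0 * g n 2 = g n 2 * g n 0 := g_zero_commute le_rfl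
  calc g n 2 * gD n * g n 2 = (g n 2 * g n 0) * g n 1 * (g n 0 * g n 2) := by
        simp only [gD, mul_assoc]
    _ = g n 0 * (g n 2 * g n 1 * g n 2) * g n 0 := by
        rw [h0, ← h0]; simp only [mul_assoc]; rw [h0]
    _ = g n 2 := by
        rw [g_succ_mul_g_mul_g_succ le_rfl, h0, mul_assoc, g_zero_mul_self hn, mul_one]

lemma augmentation_gD : augmentation n (gD n) = 0 := by
  rw [gD, map_mul, map_mul, augmentation_g le_rfl, mul_zero, zero_mul]

end Relations

/-! ### Construction of the type `D` projector by the Wenzl recursion -/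

/-- The subalgebra `TL(Dₙ)` of `TL(Bₙ)`. -/
def TLD (n : ℕ) : Subalgebra K (TLB n) :=
  Algebra.adjoin K
    ({g n 0 * g n 1 * g n 0} ∪ {y : TLB n | ∃ i : ℕ, 1 ≤ i ∧ i ≤ n - 1 ∧ y = g n i})

lemma gD_mem_TLD (n : ℕ) : gD n ∈ TLD n := Algebra.subset_adjoin (Or.inl rfl)

lemma g_mem_TLD (n : ℕ) {i : ℕ} (hi : 1 ≤ i) : g n i ∈ TLD n := by
  rcases lt_or_ge i n with h | h
  · exact Algebra.subset_adjoin (Or.inr ⟨i, hi, by omega, rfl⟩)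
  · rw [g_of_ge h]; exact zero_mem _

/-- `IsWenzlPair n k e d` collects the properties of two consecutive type `D` Jones–Wenzl
projectors `e`, `d` on `k + 1` and `k + 2` strands inside `TL(Bₙ)` that the Wenzl recursion
preserves. -/
structure IsWenzlPair (n k : ℕ) (e d : TLB n) : Prop where
  mem : d ∈ TLD n
  augmentation_eq : augmentation n d = 1
  idem : d * d = d
  left_absorb : e * d = d
  right_absorb : d * e = d
  commute_fst : ∀ j, k + 2 ≤ j → Commute e (g n j)
  commute_snd : ∀ j, k + 3 ≤ j → Commute d (g n j)
  commute_g_zero : Commute d (g n 0)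
  trace : g n (k + 2) * d * g n (k + 2) = traceCoeff (k + 1) • (e * g n (k + 2))
  gD_mul : gD n * d = 0
  mul_gD : d * gD n = 0
  g_mul : ∀ i, 1 ≤ i → i ≤ k + 1 → g n i * d = 0
  mul_g : ∀ i, 1 ≤ i → i ≤ k + 1 → d * g n i = 0

lemma isWenzlPair_zero {n : ℕ} (hn : 0 < n) :
    IsWenzlPair n 0 1 (1 - δ⁻¹ • (gD n + g n 1)) := by
  have hδ := δ_ne_zero
  have h11 : g n 1 * g n 1 = δ • g n 1 := g_mul_self le_rfl
  have hD : gD n * (1 - δ⁻¹ • (gD n + g n 1)) = 0 := by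
    rw [mul_sub, mul_smul_comm, mul_add, gD_mul_self hn, gD_mul_g_one, add_zero,
      inv_smul_smul₀ hδ, mul_one, sub_self]
  have hD' : (1 - δ⁻¹ • (gD n + g n 1)) * gD n = 0 := by
    rw [sub_mul, smul_mul_assoc, add_mul, gD_mul_self hn, g_one_mul_gD, add_zero,
      inv_smul_smul₀ hδ, one_mul, sub_self]
  have h1 : g n 1 * (1 - δ⁻¹ • (gD n + g n 1)) = 0 := by
    rw [mul_sub, mul_smul_comm, mul_add, h11, g_one_mul_gD, zero_add,
      inv_smul_smul₀ hδ, mul_one, sub_self]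
  have h1' : (1 - δ⁻¹ • (gD n + g n 1)) * g n 1 = 0 := by
    rw [sub_mul, smul_mul_assoc, add_mul, h11, gD_mul_g_one, zero_add,
      inv_smul_smul₀ hδ, one_mul, sub_self]
  refine
    { mem := sub_mem (one_mem _)
        (Subalgebra.smul_mem _ (add_mem (gD_mem_TLD n) (g_mem_TLD n le_rfl)) _)
      augmentation_eq := ?_
      idem := ?_
      left_absorb := one_mul _
      right_absorb := mul_one _
      commute_fst := fun j _ => Commute.one_left _
      commute_snd := fun j hj => (Commute.one_left _).sub_left
        (((gD_commute (by omega)).add_left (g_commute le_rfl (by omega))).smul_left _)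
      commute_g_zero := ?_
      trace := ?_
      gD_mul := hD
      mul_gD := hD'
      g_mul := ?_
      mul_g := ?_ }
  · rw [map_sub, map_smul, map_add, augmentation_gD, augmentation_g le_rfl, map_one]; simp
  · rw [mul_sub, mul_one, mul_smul_comm, mul_add, hD', h1']; simp
  · refine (Commute.one_left _).sub_left (Commute.smul_left ?_ _)
    rw [commute_iff_eq, add_mul, mul_add, gD_mul_g_zero hn, g_zero_mul_gD hn, add_comm]
  · rw [zero_add, zero_add, traceCoeff_one, mul_sub, sub_mul, mul_one, one_mul,
      g_mul_self one_le_two, mul_smul_comm, smul_mul_assoc, mul_add, add_mul,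
      g_two_mul_gD_mul_g_two hn, g_succ_mul_g_mul_g_succ le_rfl]
    exact smul_sub_smul_add_self δ δ⁻¹ (g n 2)
  · intro i hi hi'
    obtain rfl : i = 1 := by omega
    exact h1
  · intro i hi hi'
    obtain rfl : i = 1 := by omega
    exact h1'

lemma IsWenzlPair.succ {n k : ℕ} {e d : TLB n} (h : IsWenzlPair n k e d) :
    IsWenzlPair n (k + 1) d (d - (traceCoeff (k + 1))⁻¹ • (d * g n (k + 2) * d)) := by
  have hc := traceCoeff_ne_zero (k + 1)
  set c := traceCoeff (k + 1) with hcdef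
  set U := g n (k + 2) with hU
  have heU : e * U = U * e := h.commute_fst _ le_rfl
  have hUd : U * (d - c⁻¹ • (d * U * d)) = 0 := by
    have h1 : U * (d * U * d) = c • (U * d) := by
      calc U * (d * U * d) = U * d * U * d := by simp only [mul_assoc]
        _ = c • (U * d) := by
          rw [h.trace, smul_mul_assoc, heU, mul_assoc, h.left_absorb]
    rw [mul_sub, mul_smul_comm, h1, inv_smul_smul₀ hc, sub_self]
  have hdU : (d - c⁻¹ • (d * U * d)) * U = 0 := by
    have h1 : d * U * d * U = c • (d * U) := by
      calc d * U * d * U = d * (U * d * U) := by simp only [mul_assoc]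
        _ = c • (d * U) := by
          rw [h.trace, mul_smul_comm, ← mul_assoc, h.right_absorb]
    rw [sub_mul, smul_mul_assoc, h1, inv_smul_smul₀ hc, sub_self]
  have hl : d * (d - c⁻¹ • (d * U * d)) = d - c⁻¹ • (d * U * d) := by
    rw [mul_sub, mul_smul_comm, ← mul_assoc, ← mul_assoc, h.idem]
  have hr : (d - c⁻¹ • (d * U * d)) * d = d - c⁻¹ • (d * U * d) := by
    rw [sub_mul, smul_mul_assoc, mul_assoc (d * U), h.idem]
  have left_zero (x : TLB n) (hx : x * d = 0) : x * (d - c⁻¹ • (d * U * d)) = 0 := by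
    rw [← hl, ← mul_assoc, hx, zero_mul]
  have right_zero (x : TLB n) (hx : d * x = 0) : (d - c⁻¹ • (d * U * d)) * x = 0 := by
    rw [← hr, mul_assoc, hx, mul_zero]
  refine
    { mem := sub_mem h.mem (Subalgebra.smul_mem _
        (mul_mem (mul_mem h.mem (g_mem_TLD n (by omega))) h.mem) _)
      augmentation_eq := ?_
      idem := ?_
      left_absorb := hl
      right_absorb := hr
      commute_fst := fun j hj => h.commute_snd j (by omega)
      commute_snd := fun j hj => ?_
      commute_g_zero := h.commute_g_zero.sub_left (Commute.smul_left
        ((h.commute_g_zero.mul_left (g_zero_commute (by omega)).symm).mul_left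
          h.commute_g_zero) _)
      trace := ?_
      gD_mul := left_zero _ h.gD_mul
      mul_gD := right_zero _ h.mul_gD
      g_mul := ?_
      mul_g := ?_ }
  · rw [map_sub, map_smul, map_mul, map_mul, hU, augmentation_g (by omega), h.augmentation_eq]
    simp
  · rw [mul_sub, hr, mul_smul_comm, ← mul_assoc, ← mul_assoc, hr, hdU]; simp
  · have hd := h.commute_snd j (by omega)
    exact hd.sub_left (((hd.mul_left (g_commute (by omega) (by omega))).mul_left hd).smul_left _)
  · rw [traceCoeff_succ, ← hcdef]
    set V := g n (k + 1 + 2)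
    have hdV : d * V = V * d := h.commute_snd _ (by omega)
    have hVV : V * V = δ • V := g_mul_self (by omega)
    have hVUV : V * U * V = V := g_succ_mul_g_mul_g_succ (i := k + 2) (by omega)
    have h1 : V * d * V = δ • (d * V) := by
      rw [← hdV, mul_assoc, hVV, mul_smul_comm]
    have h2 : V * (d * U * d) * V = d * V := by
      calc V * (d * U * d) * V = (V * d) * U * (d * V) := by simp only [mul_assoc]
        _ = d * (V * U * V) * d := by rw [hdV, ← hdV]; simp only [mul_assoc]; rw [hdV]
        _ = d * V := by rw [hVUV, mul_assoc, ← hdV, ← mul_assoc, h.idem]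
    rw [mul_sub, sub_mul, mul_smul_comm, smul_mul_assoc, h1, h2]
    exact (sub_smul δ c⁻¹ (d * V)).symm
  · intro i hi hi'
    rcases Nat.lt_or_ge i (k + 2) with hik | hik
    · exact left_zero _ (h.g_mul i hi (by omega))
    · obtain rfl : i = k + 2 := by omega
      exact hUd
  · intro i hi hi'
    rcases Nat.lt_or_ge i (k + 2) with hik | hik
    · exact right_zero _ (h.mul_g i hi (by omega))
    · obtain rfl : i = k + 2 := by omega
      exact hdU

lemma exists_isWenzlPair {n : ℕ} (hn : 0 < n) (k : ℕ) :
    ∃ e d : TLB n, IsWenzlPair n k e d := by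
  induction k with
  | zero => exact ⟨_, _, isWenzlPair_zero hn⟩
  | succ k ih =>
    obtain ⟨e, d, h⟩ := ih
    exact ⟨_, _, h.succ⟩

lemma exists_isTypeDJW_commute {n : ℕ} (hn : 2 ≤ n) :
    ∃ d : TLB n, IsTypeDJW n d ∧ Commute d (g n 0) := by
  obtain ⟨e, d, h⟩ := exists_isWenzlPair (n := n) (by omega) (n - 2)
  refine ⟨d, ⟨h.mem, ?_, h.idem, ⟨h.gD_mul, h.mul_gD⟩, fun i hi hi' =>
    ⟨h.g_mul i hi (by omega), h.mul_g i hi (by omega)⟩⟩, h.commute_g_zero⟩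
  rintro rfl
  simpa using h.augmentation_eq

/-! ### Uniqueness -/

/-- `x` is annihilated on both sides by the generators `U₀, …, U_{n-1}` of `TL(Dₙ)`. -/
def IsKilled (n : ℕ) (x : TLB n) : Prop :=
  (gD n * x = 0 ∧ x * gD n = 0) ∧ ∀ i : ℕ, 1 ≤ i → i ≤ n - 1 → g n i * x = 0 ∧ x * g n i = 0

lemma exists_smul_of_mem_TLD {n : ℕ} {x : TLB n} (hx : x ∈ TLD n) :
    ∃ c : K, ∀ y, IsKilled n y → x * y = c • y ∧ y * x = c • y := by
  induction hx using Algebra.adjoin_induction with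
  | mem x hx =>
    refine ⟨0, fun y hy => ?_⟩
    rw [zero_smul]
    rcases hx with rfl | ⟨i, hi, hi', rfl⟩
    · exact hy.1
    · exact hy.2 i hi hi'
  | algebraMap r =>
    exact ⟨r, fun y _ => ⟨(Algebra.smul_def r y).symm,
      by rw [← Algebra.commutes, Algebra.smul_def]⟩⟩
  | add x z _ _ hx hz =>
    obtain ⟨a, ha⟩ := hx
    obtain ⟨b, hb⟩ := hz
    refine ⟨a + b, fun y hy => ⟨?_, ?_⟩⟩
    · rw [add_mul, (ha y hy).1, (hb y hy).1, add_smul]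
    · rw [mul_add, (ha y hy).2, (hb y hy).2, add_smul]
  | mul x z _ _ hx hz =>
    obtain ⟨a, ha⟩ := hx
    obtain ⟨b, hb⟩ := hz
    refine ⟨a * b, fun y hy => ⟨?_, ?_⟩⟩
    · rw [mul_assoc, (hb y hy).1, mul_smul_comm, (ha y hy).1, smul_smul, mul_comm]
    · rw [← mul_assoc, (ha y hy).2, smul_mul_assoc, (hb y hy).2, smul_smul]

lemma IsTypeDJW.isKilled {n : ℕ} {d : TLB n} (hd : IsTypeDJW n d) : IsKilled n d := hd.2.2.2

lemma IsTypeDJW.absorb {n : ℕ} {d : TLB n} (hd : IsTypeDJW n d) {y : TLB n}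
    (hy : IsKilled n y) : d * y = y ∧ y * d = y := by
  obtain ⟨c, hc⟩ := exists_smul_of_mem_TLD hd.1
  have h1 : c • d = (1 : K) • d := by rw [← (hc d hd.isKilled).1, hd.2.2.1, one_smul]
  obtain rfl : c = 1 := smul_left_injective K hd.2.1 h1
  simpa using hc y hy

lemma IsTypeDJW.unique {n : ℕ} {d d' : TLB n} (hd : IsTypeDJW n d) (hd' : IsTypeDJW n d') :
    d = d' :=
  (hd'.absorb hd.isKilled).2.symm.trans (hd.absorb hd'.isKilled).1

/-! ### Comparison with the type `B` projectors -/

lemma IsJW.isKilled {n : ℕ} (hn : 2 ≤ n) {ε : K} {b : TLB n} (hb : IsJW n ε b) :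
    IsKilled n b := by
  obtain ⟨-, -, hl, hr, hk⟩ := hb
  obtain ⟨h1, h1'⟩ := hk 1 le_rfl (by omega)
  refine ⟨⟨?_, ?_⟩, hk⟩
  · rw [gD, mul_assoc, hl, mul_smul_comm, mul_assoc, h1, mul_zero, smul_zero]
  · rw [gD, ← mul_assoc, ← mul_assoc, hr, smul_mul_assoc, h1', smul_zero, zero_mul]

lemma IsTypeDJW.exists_mul_eq {n : ℕ} (hn : 2 ≤ n) {d : TLB n} (hd : IsTypeDJW n d)
    (hc : Commute d (g n 0)) (x : TLB n) :
    ∃ a b : K, x * d = a • d + b • (g n 0 * d) := by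
  obtain ⟨x, rfl⟩ := RingQuot.mkAlgHom_surjective K (TLBRel n) x
  induction x using FreeAlgebra.induction with
  | grade0 r =>
    refine ⟨r, 0, ?_⟩
    rw [AlgHom.commutes, zero_smul, add_zero, Algebra.smul_def]
  | grade1 i =>
    rw [← g_of_lt i.2]
    rcases Nat.eq_zero_or_pos i with h | h
    · exact ⟨0, 1, by rw [h, zero_smul, zero_add, one_smul]⟩
    · exact ⟨0, 0, by rw [(hd.isKilled.2 i h (by omega)).1]; simp⟩
  | mul x y hx hy =>
    obtain ⟨a, b, hx⟩ := hx
    obtain ⟨a', b', hy⟩ := hy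
    have hx' : RingQuot.mkAlgHom K (TLBRel n) x * (g n 0 * d) = a • (g n 0 * d) + b • d := by
      rw [← hc.eq, ← mul_assoc, hx, add_mul, smul_mul_assoc, smul_mul_assoc, mul_assoc, hc.eq,
        ← mul_assoc, g_zero_mul_self (by omega), one_mul]
    refine ⟨a' * a + b' * b, a' * b + b' * a, ?_⟩
    rw [map_mul, mul_assoc, hy, mul_add, mul_smul_comm, mul_smul_comm, hx, hx']
    exact smul_add_smul_swap a b a' b' d (g n 0 * d)
  | add x y hx hy =>
    obtain ⟨a, b, hx⟩ := hx
    obtain ⟨a', b', hy⟩ := hy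
    refine ⟨a + a', b + b', ?_⟩
    rw [map_add, add_mul, hx, hy]
    exact smul_add_smul_add_smul_add_smul a b a' b' d (g n 0 * d)

lemma IsJW.eq_of_isTypeDJW {n : ℕ} (hn : 2 ≤ n) {ε : K} (hε : ε * ε = 1) {b d : TLB n}
    (hb : IsJW n ε b) (hd : IsTypeDJW n d) (hc : Commute d (g n 0)) :
    b = (2⁻¹ : K) • (d + ε • (g n 0 * d)) := by
  have hs : g n 0 * (g n 0 * d) = d := by
    rw [← mul_assoc, g_zero_mul_self (by omega), one_mul]
  obtain ⟨x, y, hxy⟩ := hd.exists_mul_eq hn hc b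
  rw [(hd.absorb (hb.isKilled hn)).2] at hxy
  set p : TLB n := (2⁻¹ : K) • (d + ε • (g n 0 * d)) with hp
  have hsb : g n 0 * b = x • (g n 0 * d) + y • d := by
    rw [hxy, mul_add, mul_smul_comm, mul_smul_comm, hs]
  have hbp : b = (x + ε * y) • p := by
    have h1 : b = (2⁻¹ : K) • (b + ε • (g n 0 * b)) := by
      rw [hb.2.2.1, smul_smul, hε, one_smul, ← two_smul K b, inv_smul_smul₀ two_ne_zero]
    rw [h1, hsb, hxy, hp]
    exact half_smul_add_smul_swap hε x y d (g n 0 * d)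
  have hpb : p * b = b := by
    rw [hp, smul_mul_assoc, add_mul, smul_mul_assoc, mul_assoc,
      (hd.absorb (hb.isKilled hn)).1, hb.2.2.1, smul_smul, hε, one_smul, ← two_smul K b,
      inv_smul_smul₀ two_ne_zero]
  have h1 : (x + ε * y) • b = (1 : K) • b := by
    conv_lhs => rw [← hpb]
    rw [← smul_mul_assoc, ← hbp, hb.2.1, one_smul]
  have h2 : x + ε * y = 1 := smul_left_injective K hb.1 h1
  rw [hbp, h2, one_smul]

/-- For `n ≥ 2` there exists a unique `d` in the subalgebra `TL(Dₙ)` of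
`TL(Bₙ)` with `d ≠ 0`, `d² = d` and `Uᵢ·d = 0 = d·Uᵢ` for all `0 ≤ i ≤ n-1` (where
`U₀ = s₀U₁s₀`); moreover this element equals `b_{n,+} + b_{n,-}`, the sum of the two type `B`
Jones–Wenzl projectors (the type `D` Jones–Wenzl projector `dₙ`). -/
theorem stmt_15 (n : ℕ) (hn : 2 ≤ n) :
    (∃! d : TLB n, IsTypeDJW n d) ∧
    ∀ bp bm : TLB n, IsJW n 1 bp → IsJW n (-1) bm → IsTypeDJW n (bp + bm) := by
  obtain ⟨d, hd, hc⟩ := exists_isTypeDJW_commute hn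
  refine ⟨⟨d, hd, fun d' hd' => hd'.unique hd⟩, fun bp bm hp hm => ?_⟩
  have hsum : bp + bm = d := by
    rw [hp.eq_of_isTypeDJW hn (by norm_num) hd hc, hm.eq_of_isTypeDJW hn (by norm_num) hd hc]
    exact half_smul_add_half_smul_neg d (g n 0 * d)
  rwa [hsum]
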